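/- Let d ≥ 1 and γ ∈ (0,1). There exists a constant C > 0, depending only on d and γ, such that the following interior Schauder gradient estimate holds. Let t₀ ∈ ℝ, x₀ ∈ ℝ^d, r > 0, and set Q = [t₀ − r, t₀] × closedBall(x₀, √r) and Q' = [t₀ − r/2, t₀] × closedBall(x₀, √(r/2)). Let u : ℝ × ℝ^d → ℝ be bounded on Q, of class C¹ in time and C² in space on Q, and satisfy at every point (t,x) of Q: ∂_t u(t,x) − Δu(t,x) + a(t,x)·u(t,x) = b(t,x)·∇u(t,x) + f(t,x), where a, f : ℝ × ℝ^d → ℝ and b : ℝ × ℝ^d → ℝ^d satisfy a ≥ 0 on Q and have finite parabolic Hölder seminorms ‖a‖_{γ,Q}, ‖b‖_{γ,Q}, ‖f‖_{γ,Q}. Set R_b = (1 + √r·‖b(t₀,x₀)‖)^{-1}. Then sup_{(t,x)∈Q'} ‖∇u(t,x)‖ ≤ C·√r·R_b^{-1}·( r^{γ/2}·‖f‖_{γ,Q} + ( r^γ·R_b^{-1}·‖b‖_{γ,Q}² + r^{γ/2}·‖a‖_{γ,Q} + r^{-1} )·sup_{Q}|u| ). -/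

import Mathlib

open scoped RealInnerProductSpace

/-- The parabolic ball `Q = [t₀ - r, t₀] × closedBall(x₀, √r)`. -/
def parabolicBall (d : ℕ) (t₀ : ℝ) (x₀ : EuclideanSpace ℝ (Fin d)) (r : ℝ) :
    Set (ℝ × EuclideanSpace ℝ (Fin d)) :=
  Set.Icc (t₀ - r) t₀ ×ˢ Metric.closedBall x₀ (Real.sqrt r)

lemma aux_second_test {F F' : ℝ → ℝ} {c : ℝ} (hmax : IsLocalMax F 0)
    (hF : ∀ᶠ s in nhds (0:ℝ), HasDerivAt F (F' s) s) (hc : HasDerivAt F' c 0) : c ≤ 0 := by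
  by_contra hpos
  push Not at hpos
  have h1 : deriv F =ᶠ[nhds 0] F' := hF.mono fun s hs => hs.deriv
  have h2 : deriv (deriv F) 0 = c := by rw [h1.deriv_eq]; exact hc.deriv
  have hmin : IsLocalMin F 0 :=
    isLocalMin_of_deriv_deriv_pos (by rw [h2]; exact hpos) hmax.deriv_eq_zero
      hF.self_of_nhds.continuousAt
  have h3 : F =ᶠ[nhds 0] fun _ => F 0 := by
    filter_upwards [hmax, hmin] with s hs1 hs2
    exact le_antisymm hs1 hs2
  have h4 : deriv F =ᶠ[nhds 0] fun _ => 0 := by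
    have := h3.deriv
    simpa using this
  rw [h4.deriv_eq] at h2
  simp at h2
  linarith

lemma aux_left {F : ℝ → ℝ} {c T : ℝ} (hF : HasDerivAt F c T)
    (h : ∀ᶠ s in nhdsWithin T (Set.Iio T), F s ≤ F T) : 0 ≤ c := by
  have h1 : Filter.Tendsto (slope F T) (nhdsWithin T (Set.Iio T)) (nhds c) :=
    (hasDerivAt_iff_tendsto_slope.1 hF).mono_left
    (nhdsWithin_mono T (fun s (hs : s < T) => (ne_of_lt hs : s ∈ ({T}ᶜ : Set ℝ))))
  refine ge_of_tendsto h1 ?_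
  filter_upwards [h, self_mem_nhdsWithin] with s hs hsT
  rw [slope_def_field]
  have : s < T := hsT
  exact div_nonneg_of_nonpos (by linarith) (by linarith)

lemma aux_right {F : ℝ → ℝ} {c T : ℝ} (hF : HasDerivAt F c T)
    (h : ∀ᶠ s in nhdsWithin T (Set.Ioi T), F s ≤ F T) : c ≤ 0 := by
  have h1 : Filter.Tendsto (slope F T) (nhdsWithin T (Set.Ioi T)) (nhds c) :=
    (hasDerivAt_iff_tendsto_slope.1 hF).mono_left
    (nhdsWithin_mono T (fun s (hs : T < s) => (ne_of_gt hs : s ∈ ({T}ᶜ : Set ℝ))))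
  refine le_of_tendsto h1 ?_
  filter_upwards [h, self_mem_nhdsWithin] with s hs hsT
  rw [slope_def_field]
  have : T < s := hsT
  exact div_nonpos_of_nonpos_of_nonneg (by linarith) (by linarith)

section
variable {E : Type*} [NormedAddCommGroup E] [InnerProductSpace ℝ E] [CompleteSpace E]

lemma aux_line {v : E → ℝ} {g Y b : E} {s : ℝ} (h : HasGradientAt v g (Y + s • b)) :
    HasDerivAt (fun s : ℝ => v (Y + s • b)) ⟪g, b⟫ s := by
  have h1 : HasDerivAt (fun s : ℝ => Y + s • b) b s := by
    simpa using ((hasDerivAt_id s).smul_const b).const_add Y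
  have := HasFDerivAt.comp_hasDerivAt s h.hasFDerivAt h1
  exact this.congr_deriv (by simp)

lemma aux_line2 {v : E → E} {L : E →L[ℝ] E} {Y b : E} {s : ℝ} (h : HasFDerivAt v L (Y + s • b)) :
    HasDerivAt (fun s : ℝ => ⟪v (Y + s • b), b⟫) ⟪L b, b⟫ s := by
  have h1 : HasDerivAt (fun s : ℝ => Y + s • b) b s := by
    simpa using ((hasDerivAt_id s).smul_const b).const_add Y
  have := (HasFDerivAt.comp_hasDerivAt s h h1).inner ℝ (hasDerivAt_const s b)
  simpa using this

lemma aux_cont {u ut : ℝ × E → ℝ} {gu : ℝ × E → E} {I : Set ℝ} {S : Set E}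
    (hI : IsCompact I) (hI' : Convex ℝ I) (hS : IsCompact S) (hS' : Convex ℝ S)
    (h1 : ∀ p ∈ I ×ˢ S, HasDerivAt (fun τ => u (τ, p.2)) (ut p) p.1)
    (c1 : ContinuousOn ut (I ×ˢ S))
    (h2 : ∀ p ∈ I ×ˢ S, HasGradientAt (fun ξ => u (p.1, ξ)) (gu p) p.2)
    (c2 : ContinuousOn gu (I ×ˢ S)) : ContinuousOn u (I ×ˢ S) := by
  obtain ⟨C1, hC1⟩ := (hI.prod hS).exists_bound_of_continuousOn c1
  obtain ⟨C2, hC2⟩ := (hI.prod hS).exists_bound_of_continuousOn c2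
  rw [Metric.continuousOn_iff']
  rintro ⟨t, x⟩ ⟨ht, hx⟩ ε hε
  simp only at ht hx
  have key : ∀ p ∈ I ×ˢ S, dist (u p) (u (t, x)) ≤ C1 * ‖p.1 - t‖ + C2 * ‖p.2 - x‖ := by
    rintro ⟨s, y⟩ ⟨hs, hy⟩
    simp only at hs hy
    have e1 : ‖u (s, y) - u (t, y)‖ ≤ C1 * ‖s - t‖ :=
      Convex.norm_image_sub_le_of_norm_hasDerivWithin_le (f := fun τ => u (τ, y))
        (f' := fun τ => ut (τ, y)) (s := I)
        (fun τ hτ => (h1 (τ, y) ⟨hτ, hy⟩).hasDerivWithinAt)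
        (fun τ hτ => hC1 (τ, y) ⟨hτ, hy⟩) hI' ht hs
    have e2 : ‖u (t, y) - u (t, x)‖ ≤ C2 * ‖y - x‖ :=
      Convex.norm_image_sub_le_of_norm_hasFDerivWithin_le (𝕜 := ℝ) (f := fun ξ => u (t, ξ))
        (f' := fun ξ => InnerProductSpace.toDual ℝ E (gu (t, ξ))) (s := S)
        (fun ξ hξ => (h2 (t, ξ) ⟨ht, hξ⟩).hasFDerivAt.hasFDerivWithinAt)
        (fun ξ hξ => by simpa using hC2 (t, ξ) ⟨ht, hξ⟩) hS' hx hy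
    rw [dist_eq_norm]
    calc ‖u (s, y) - u (t, x)‖ = ‖(u (s, y) - u (t, y)) + (u (t, y) - u (t, x))‖ := by
          congr 1; ring
      _ ≤ _ := (norm_add_le _ _).trans (add_le_add e1 e2)
  have lim : Filter.Tendsto (fun p : ℝ × E => C1 * ‖p.1 - t‖ + C2 * ‖p.2 - x‖)
      (nhds (t, x)) (nhds 0) := by
    have : Continuous (fun p : ℝ × E => C1 * ‖p.1 - t‖ + C2 * ‖p.2 - x‖) := by fun_prop
    simpa using this.tendsto (t, x)
  filter_upwards [self_mem_nhdsWithin, mem_nhdsWithin_of_mem_nhds (lim.eventually_lt_const hε)]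
    with p hp hp2
  exact (key p hp).trans_lt hp2
end

lemma aux_trace {d : ℕ} (L : EuclideanSpace ℝ (Fin d) →L[ℝ] EuclideanSpace ℝ (Fin d))
    (b : OrthonormalBasis (Fin d) ℝ (EuclideanSpace ℝ (Fin d))) :
    ∑ i : Fin d, L (EuclideanSpace.single i 1) i = ∑ i, ⟪L (b i), b i⟫ := by
  have h1 := LinearMap.trace_eq_sum_inner (L : EuclideanSpace ℝ (Fin d) →ₗ[ℝ] EuclideanSpace ℝ (Fin d)) b
  have h2 := LinearMap.trace_eq_sum_inner (L : EuclideanSpace ℝ (Fin d) →ₗ[ℝ] EuclideanSpace ℝ (Fin d))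
    (EuclideanSpace.basisFun (Fin d) ℝ)
  rw [h1] at h2
  have h3 : ∀ i : Fin d, L (EuclideanSpace.single i 1) i =
      ⟪EuclideanSpace.basisFun (Fin d) ℝ i, L (EuclideanSpace.basisFun (Fin d) ℝ i)⟫ := by
    intro i
    rw [EuclideanSpace.basisFun_apply, EuclideanSpace.inner_single_left]
    simp
  rw [Finset.sum_congr rfl fun i _ => h3 i]
  refine h2.symm.trans (Finset.sum_congr rfl fun i _ => ?_)
  exact real_inner_comm _ _

lemma aux_comparison {d : ℕ} {u ut : ℝ × EuclideanSpace ℝ (Fin d) → ℝ}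
    {gu : ℝ × EuclideanSpace ℝ (Fin d) → EuclideanSpace ℝ (Fin d)}
    {hu : ℝ × EuclideanSpace ℝ (Fin d) →
            (EuclideanSpace ℝ (Fin d) →L[ℝ] EuclideanSpace ℝ (Fin d))}
    {T l M N a0 f0 : ℝ} {X e : EuclideanSpace ℝ (Fin d)} (hl : 0 < l) (ha : 0 ≤ a0)
    (he : ‖e‖ = 1)
    (hM : ∀ p ∈ Set.Icc (T - l^2) T ×ˢ Metric.closedBall X l, |u p| ≤ M)
    (h1 : ∀ p ∈ Set.Icc (T - l^2) T ×ˢ Metric.closedBall X l,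
      HasDerivAt (fun τ => u (τ, p.2)) (ut p) p.1)
    (c1 : ContinuousOn ut (Set.Icc (T - l^2) T ×ˢ Metric.closedBall X l))
    (h2 : ∀ p ∈ Set.Icc (T - l^2) T ×ˢ Metric.closedBall X l,
      HasGradientAt (fun ξ => u (p.1, ξ)) (gu p) p.2)
    (c2 : ContinuousOn gu (Set.Icc (T - l^2) T ×ˢ Metric.closedBall X l))
    (h3 : ∀ p ∈ Set.Icc (T - l^2) T ×ˢ Metric.closedBall X l,
      HasFDerivAt (fun ξ => gu (p.1, ξ)) (hu p) p.2)
    (hN : ∀ p ∈ Set.Icc (T - l^2) T ×ˢ Metric.closedBall X l,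
      |ut p - (∑ i : Fin d, hu p (EuclideanSpace.single i 1) i) + a0 * u p - f0| ≤ N)
    {A H : ℝ} (hA : A * l^2 = 2 * M) (hH : A * (1 + 2 * d) + 2 * N < 2 * H) :
    ∀ s ∈ Set.Icc (0:ℝ) l, u (T, X + s • e) - u (T, X + (-s) • e) ≤
      A * s ^ 2 + H * (l * s - s ^ 2) := by
  set R := (ℝ ∙ e)ᗮ.reflection with hR
  have hRe : R e = - e := Submodule.reflection_orthogonalComplement_singleton_eq_neg e
  have hRp : ∀ z, ⟪e, z⟫ = 0 → R z = z := fun z hz =>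
    Submodule.reflection_mem_subspace_eq_self (Submodule.mem_orthogonal_singleton_iff_inner_right.2 hz)
  have hRn : ∀ z, ‖R z‖ = ‖z‖ := fun z => R.norm_map z
  have hX : (T, X) ∈ Set.Icc (T - l^2) T ×ˢ Metric.closedBall X l :=
    ⟨⟨by simp only; nlinarith, le_refl T⟩, Metric.mem_closedBall_self hl.le⟩
  have hM0 : 0 ≤ M := (abs_nonneg _).trans (hM _ hX)
  have hN0 : 0 ≤ N := (abs_nonneg _).trans (hN _ hX)
  have hA0 : 0 ≤ A := by
    by_contra hneg
    push Not at hneg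
    nlinarith [mul_pos_of_neg_of_neg hneg (neg_lt_zero.2 (pow_pos hl 2))]
  have hH0 : 0 ≤ H := by
    have : 0 ≤ A * (1 + 2 * d) := by positivity
    linarith
  have hcu : ContinuousOn u (Set.Icc (T - l^2) T ×ˢ Metric.closedBall X l) :=
    aux_cont isCompact_Icc (convex_Icc _ _) (isCompact_closedBall _ _) (convex_closedBall _ _)
      h1 c1 h2 c2
  -- the half cylinder
  set S : Set (EuclideanSpace ℝ (Fin d)) := {z | ‖z‖ ≤ l ∧ 0 ≤ ⟪e, z⟫} with hS
  have hScomp : IsCompact S := by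
    have : S = Metric.closedBall 0 l ∩ {z | 0 ≤ ⟪e, z⟫} := by
      ext z; simp [hS]
    rw [this]
    exact (isCompact_closedBall _ _).inter_right
      (isClosed_le continuous_const (by fun_prop))
  have hmem : ∀ t ∈ Set.Icc (T - l^2) T, ∀ z, ‖z‖ ≤ l →
      (t, X + z) ∈ Set.Icc (T - l^2) T ×ˢ Metric.closedBall X l := by
    intro t ht z hz
    exact ⟨ht, by simpa using hz⟩
  set h : ℝ × EuclideanSpace ℝ (Fin d) → ℝ := fun p =>
    u (p.1, X + p.2) - u (p.1, X + R p.2) - A * (‖p.2‖ ^ 2 + (T - p.1))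
      - H * (l * ⟪e, p.2⟫ - ⟪e, p.2⟫ ^ 2) with hh
  have hcont : ContinuousOn h (Set.Icc (T - l^2) T ×ˢ S) := by
    have k1 : ContinuousOn (fun p : ℝ × EuclideanSpace ℝ (Fin d) => u (p.1, X + p.2))
        (Set.Icc (T - l^2) T ×ˢ S) := by
      refine hcu.comp (f := fun p : ℝ × EuclideanSpace ℝ (Fin d) => (p.1, X + p.2))
        (by fun_prop) ?_
      rintro ⟨t, z⟩ ⟨ht, hz⟩
      exact hmem t ht z hz.1
    have k2 : ContinuousOn (fun p : ℝ × EuclideanSpace ℝ (Fin d) => u (p.1, X + R p.2))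
        (Set.Icc (T - l^2) T ×ˢ S) := by
      refine hcu.comp (f := fun p : ℝ × EuclideanSpace ℝ (Fin d) => (p.1, X + R p.2))
        (by fun_prop) ?_
      rintro ⟨t, z⟩ ⟨ht, hz⟩
      exact hmem t ht (R z) (by rw [hRn]; exact hz.1)
    refine ((k1.sub k2).sub ?_).sub ?_
    · exact Continuous.continuousOn (by fun_prop)
    · exact Continuous.continuousOn (by fun_prop)
  have hne : (Set.Icc (T - l^2) T ×ˢ S).Nonempty :=
    ⟨(T, 0), ⟨hX.1, by simp [hS, hl.le]⟩⟩
  obtain ⟨⟨t, z⟩, ⟨ht, hz⟩, hmax⟩ := ((isCompact_Icc (a := T - l^2) (b := T)).prod hScomp).exists_isMaxOn hne hcont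
  simp only at ht hz
  have hmax' : ∀ t' ∈ Set.Icc (T - l^2) T, ∀ z' ∈ S, h (t', z') ≤ h (t, z) :=
    fun t' ht' z' hz' => hmax ⟨ht', hz'⟩
  have hey : ∀ z : EuclideanSpace ℝ (Fin d), ‖z‖ ≤ l → ⟪e, z⟫ ≤ l := fun z hz =>
    (real_inner_le_norm _ _).trans (by rw [he, one_mul]; exact hz)
  -- the maximum is nonpositive
  have hneg : h (t, z) ≤ 0 := by
    by_contra hpos
    push Not at hpos
    have hy0 := hz.2
    have hyl := hey z hz.1
    have hbar : 0 ≤ H * (l * ⟪e, z⟫ - ⟪e, z⟫ ^ 2) := by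
      apply mul_nonneg hH0; nlinarith
    have hbar2 : 0 ≤ A * (‖z‖ ^ 2 + (T - t)) := by
      apply mul_nonneg hA0; nlinarith [ht.2, sq_nonneg ‖z‖]
    have m1 := hmem t ht z hz.1
    have m2 := hmem t ht (R z) (by rw [hRn]; exact hz.1)
    have b1 := abs_le.1 (hM _ m1)
    have b2 := abs_le.1 (hM _ m2)
    have hpos' : 0 < u (t, X + z) - u (t, X + R z) - A * (‖z‖ ^ 2 + (T - t))
      - H * (l * ⟪e, z⟫ - ⟪e, z⟫ ^ 2) := hpos
    have hw : 0 < u (t, X + z) - u (t, X + R z) := by linarith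
    have hsmall : A * (‖z‖ ^ 2 + (T - t)) < A * l ^ 2 := by linarith
    have hsmall' : ‖z‖ ^ 2 + (T - t) < l ^ 2 := lt_of_mul_lt_mul_left hsmall hA0
    have hzl : ‖z‖ < l := by
      apply lt_of_pow_lt_pow_left₀ 2 hl.le; linarith [ht.2]
    have htl : T - l ^ 2 < t := by linarith [sq_nonneg ‖z‖]
    have hy : 0 < ⟪e, z⟫ := by
      rcases hy0.lt_or_eq with h | h
      · exact h
      · rw [hRp z h.symm] at hw; simp at hw
    -- time derivative
    have d1 : 0 ≤ ut (t, X + z) - ut (t, X + R z) + A := by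
      have hd : HasDerivAt (fun τ => h (τ, z)) (ut (t, X + z) - ut (t, X + R z) - A * (0 - 1)) t := by
        have q1 := h1 _ m1
        have q2 := h1 _ m2
        have q := ((q1.sub q2).sub
          ((((hasDerivAt_id t).const_sub T).const_add (‖z‖^2)).const_mul A)).sub_const
            (H * (l * ⟪e, z⟫ - ⟪e, z⟫ ^ 2))
        exact q.congr_deriv (by simp)
      have := aux_left hd (by
        filter_upwards [Ioo_mem_nhdsLT htl] with s hs
        exact hmax' s ⟨hs.1.le, hs.2.le.trans ht.2⟩ z hz)
      linarith
    -- space derivatives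
    have d2 : ∀ i : Fin d, ∀ b : EuclideanSpace ℝ (Fin d), ‖b‖ = 1 →
        ⟪hu (t, X + z) b, b⟫ - ⟪hu (t, X + R z) (R b), R b⟫ - 2 * A + 2 * H * ⟪e, b⟫ ^ 2 ≤ 0 := by
      intro _ b hb
      have hev : ∀ᶠ s in nhds (0:ℝ), ‖z + s • b‖ < l ∧ 0 < ⟪e, z + s • b⟫ := by
        have q1 : Continuous fun s : ℝ => ‖z + s • b‖ := by fun_prop
        have q2 : Continuous fun s : ℝ => ⟪e, z + s • b⟫ := by fun_prop
        exact (q1.continuousAt.eventually_lt_const (by simpa using hzl)).and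
          (q2.continuousAt.eventually_const_lt (by simpa using hy))
      refine aux_second_test (F := fun s => u (t, (X + z) + s • b) - u (t, (X + R z) + s • R b)
          - A * (‖z‖ ^ 2 + 2 * s * ⟪z, b⟫ + s ^ 2 + (T - t))
          - H * (l * (⟪e, z⟫ + s * ⟪e, b⟫) - (⟪e, z⟫ + s * ⟪e, b⟫) ^ 2))
        (F' := fun s => ⟪gu (t, (X + z) + s • b), b⟫ - ⟪gu (t, (X + R z) + s • R b), R b⟫
          - A * (2 * ⟪z, b⟫ + 2 * s)
          - H * (l * ⟪e, b⟫ - 2 * (⟪e, z⟫ + s * ⟪e, b⟫) * ⟪e, b⟫)) ?_ ?_ ?_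
      · have hF : ∀ s, u (t, (X + z) + s • b) - u (t, (X + R z) + s • R b)
          - A * (‖z‖ ^ 2 + 2 * s * ⟪z, b⟫ + s ^ 2 + (T - t))
          - H * (l * (⟪e, z⟫ + s * ⟪e, b⟫) - (⟪e, z⟫ + s * ⟪e, b⟫) ^ 2) = h (t, z + s • b) := by
          intro s
          simp only [hh, map_add, map_smul, add_assoc, inner_add_right, inner_smul_right,
            norm_add_sq_real, norm_smul, hb, Real.norm_eq_abs, mul_one, sq_abs]
          ring
        simp only [hF]
        filter_upwards [hev] with s hs
        have := hmax' t ht (z + s • b) ⟨hs.1.le, hs.2.le⟩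
        simpa using this
      · filter_upwards [hev] with s hs
        have n1 : (t, X + z + s • b) ∈ Set.Icc (T - l^2) T ×ˢ Metric.closedBall X l := by
          rw [add_assoc]; exact hmem t ht _ hs.1.le
        have n2 : (t, X + R z + s • R b) ∈ Set.Icc (T - l^2) T ×ˢ Metric.closedBall X l := by
          rw [add_assoc, ← map_smul, ← map_add]; exact hmem t ht _ (by rw [hRn]; exact hs.1.le)
        have r1 := aux_line (h2 _ n1)
        have r2 := aux_line (h2 _ n2)
        have r3 : HasDerivAt (fun s : ℝ => A * (‖z‖ ^ 2 + 2 * s * ⟪z, b⟫ + s ^ 2 + (T - t)))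
            (A * (2 * ⟪z, b⟫ + 2 * s)) s := by
          have := (((((hasDerivAt_id s).const_mul 2).mul_const ⟪z, b⟫).const_add (‖z‖^2)).add
            (hasDerivAt_pow 2 s)).add_const (T - t) |>.const_mul A
          exact this.congr_deriv (by simp)
        have r4 : HasDerivAt (fun s : ℝ => H * (l * (⟪e, z⟫ + s * ⟪e, b⟫) - (⟪e, z⟫ + s * ⟪e, b⟫) ^ 2))
            (H * (l * ⟪e, b⟫ - 2 * (⟪e, z⟫ + s * ⟪e, b⟫) * ⟪e, b⟫)) s := by
          have k : HasDerivAt (fun s : ℝ => ⟪e, z⟫ + s * ⟪e, b⟫) ⟪e, b⟫ s := by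
            simpa using ((hasDerivAt_id s).mul_const ⟪e, b⟫).const_add ⟪e, z⟫
          have := ((k.const_mul l).sub (k.pow 2)).const_mul H
          exact this.congr_deriv (by simp)
        exact ((r1.sub r2).sub r3).sub r4
      · have r1 := aux_line2 (v := fun ξ => gu (t, ξ)) (Y := X + z) (b := b) (s := 0)
          (L := hu (t, X + z)) (by simpa using h3 _ m1)
        have r2 := aux_line2 (v := fun ξ => gu (t, ξ)) (Y := X + R z) (b := R b) (s := 0)
          (L := hu (t, X + R z)) (by simpa using h3 _ m2)
        have r3 : HasDerivAt (fun s : ℝ => A * (2 * ⟪z, b⟫ + 2 * s)) (A * 2) 0 := by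
          simpa using (((hasDerivAt_id (0:ℝ)).const_mul 2).const_add (2 * ⟪z, b⟫)).const_mul A
        have r4 : HasDerivAt (fun s : ℝ => H * (l * ⟪e, b⟫ - 2 * (⟪e, z⟫ + s * ⟪e, b⟫) * ⟪e, b⟫))
            (H * (-(2 * ⟪e, b⟫ * ⟪e, b⟫))) 0 := by
          have k : HasDerivAt (fun s : ℝ => ⟪e, z⟫ + s * ⟪e, b⟫) ⟪e, b⟫ 0 := by
            simpa using ((hasDerivAt_id (0:ℝ)).mul_const ⟪e, b⟫).const_add ⟪e, z⟫
          simpa using (((k.const_mul 2).mul_const ⟪e, b⟫).const_sub (l * ⟪e, b⟫)).const_mul H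
        exact (((r1.sub r2).sub r3).sub r4).congr_deriv (by ring)
    have bb := EuclideanSpace.basisFun (Fin d) ℝ
    have s1 := aux_trace (hu (t, X + z)) bb
    have s2 := aux_trace (hu (t, X + R z)) (bb.map R)
    have s3 := bb.sum_sq_inner_left e
    have s4 : ∑ i : Fin d, (⟪hu (t, X + z) (bb i), bb i⟫ -
        ⟪hu (t, X + R z) (R (bb i)), R (bb i)⟫ - 2 * A + 2 * H * ⟪e, bb i⟫ ^ 2) ≤ 0 :=
      Finset.sum_nonpos fun i _ => d2 i (bb i) (bb.orthonormal.1 i)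
    simp only [OrthonormalBasis.map_apply] at s2
    rw [Finset.sum_add_distrib, Finset.sum_sub_distrib, Finset.sum_sub_distrib, ← s1, ← s2,
      ← Finset.mul_sum (f := fun i => ⟪e, bb i⟫ ^ 2), s3, he] at s4
    simp only [Finset.sum_const, Finset.card_univ, Fintype.card_fin, nsmul_eq_mul] at s4
    have g1 := (abs_le.1 (hN _ m1)).2
    have g2 := (abs_le.1 (hN _ m2)).1
    have g3 := mul_nonneg ha hw.le
    nlinarith
  intro s hs
  have q := hmax' T ⟨by nlinarith, le_refl T⟩ (s • e) ⟨by
    rw [norm_smul, he, Real.norm_eq_abs, abs_of_nonneg hs.1, mul_one]; exact hs.2, by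
    rw [inner_smul_right, real_inner_self_eq_norm_sq, he]; simpa using hs.1⟩
  have q2 := q.trans hneg
  simp only [hh, map_smul, hRe, inner_smul_right, real_inner_self_eq_norm_sq, he, norm_smul,
    Real.norm_eq_abs, mul_pow, sq_abs, smul_neg, neg_smul] at q2 ⊢
  linarith

lemma aux_gradient {d : ℕ} {u ut : ℝ × EuclideanSpace ℝ (Fin d) → ℝ}
    {gu : ℝ × EuclideanSpace ℝ (Fin d) → EuclideanSpace ℝ (Fin d)}
    {hu : ℝ × EuclideanSpace ℝ (Fin d) →
            (EuclideanSpace ℝ (Fin d) →L[ℝ] EuclideanSpace ℝ (Fin d))}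
    {T l M N a0 f0 : ℝ} {X : EuclideanSpace ℝ (Fin d)} (hl : 0 < l) (ha : 0 ≤ a0)
    (hM : ∀ p ∈ Set.Icc (T - l^2) T ×ˢ Metric.closedBall X l, |u p| ≤ M)
    (h1 : ∀ p ∈ Set.Icc (T - l^2) T ×ˢ Metric.closedBall X l,
      HasDerivAt (fun τ => u (τ, p.2)) (ut p) p.1)
    (c1 : ContinuousOn ut (Set.Icc (T - l^2) T ×ˢ Metric.closedBall X l))
    (h2 : ∀ p ∈ Set.Icc (T - l^2) T ×ˢ Metric.closedBall X l,
      HasGradientAt (fun ξ => u (p.1, ξ)) (gu p) p.2)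
    (c2 : ContinuousOn gu (Set.Icc (T - l^2) T ×ˢ Metric.closedBall X l))
    (h3 : ∀ p ∈ Set.Icc (T - l^2) T ×ˢ Metric.closedBall X l,
      HasFDerivAt (fun ξ => gu (p.1, ξ)) (hu p) p.2)
    (hN : ∀ p ∈ Set.Icc (T - l^2) T ×ˢ Metric.closedBall X l,
      |ut p - (∑ i : Fin d, hu p (EuclideanSpace.single i 1) i) + a0 * u p - f0| ≤ N) :
    ‖gu (T, X)‖ ≤ (d + 1) * M / l + N * l / 2 := by
  have hX : (T, X) ∈ Set.Icc (T - l^2) T ×ˢ Metric.closedBall X l :=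
    ⟨⟨by simp only; nlinarith, le_refl T⟩, Metric.mem_closedBall_self hl.le⟩
  have hM0 : 0 ≤ M := (abs_nonneg _).trans (hM _ hX)
  have hN0 : 0 ≤ N := (abs_nonneg _).trans (hN _ hX)
  rcases eq_or_ne (gu (T, X)) 0 with h0 | h0
  · rw [h0, norm_zero]; positivity
  have hn : 0 < ‖gu (T, X)‖ := norm_pos_iff.2 h0
  set e := (‖gu (T, X)‖)⁻¹ • gu (T, X) with hedef
  have he : ‖e‖ = 1 := by rw [hedef, norm_smul, norm_inv, norm_norm, inv_mul_cancel₀ hn.ne']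
  have hge : ⟪gu (T, X), e⟫ = ‖gu (T, X)‖ := by
    rw [hedef, inner_smul_right, real_inner_self_eq_norm_sq]; field_simp
  set A := 2 * M / l ^ 2 with hAdef
  have hA : A * l ^ 2 = 2 * M := by rw [hAdef]; field_simp
  have hA0 : 0 ≤ A := by positivity
  have step : ∀ ε > 0, ‖gu (T, X)‖ ≤ (d + 1) * M / l + N * l / 2 + ε := by
    intro ε hε
    set H := A * (1 + d) + N + 2 * ε / l with hHdef
    have hε' : 0 < 2 * ε / l := by positivity
    have cmp := aux_comparison hl ha he hM h1 c1 h2 c2 h3 hN (A := A) (H := H) hA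
      (by rw [hHdef]; nlinarith)
    have k1 : HasDerivAt (fun s : ℝ => u (T, X + s • e)) ⟪gu (T, X), e⟫ 0 :=
      aux_line (v := fun ξ => u (T, ξ)) (by simpa using h2 _ hX)
    have k2 : HasDerivAt (fun s : ℝ => u (T, X + (-s) • e)) (-⟪gu (T, X), e⟫) 0 := by
      have := aux_line (v := fun ξ => u (T, ξ)) (Y := X) (b := -e) (s := 0) (g := gu (T, X))
        (by simpa using h2 _ hX)
      simpa using this
    have k3 : HasDerivAt (fun s : ℝ => A * s ^ 2 + H * (l * s - s ^ 2)) (H * l) 0 := by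
      have := ((hasDerivAt_pow 2 (0:ℝ)).const_mul A).add
        ((((hasDerivAt_id (0:ℝ)).const_mul l).sub (hasDerivAt_pow 2 (0:ℝ))).const_mul H)
      exact this.congr_deriv (by simp)
    have k4 := aux_right ((k1.sub k2).sub k3) (by
      filter_upwards [Ioo_mem_nhdsGT hl] with s hs
      have := cmp s ⟨hs.1.le, hs.2.le⟩
      simp only [Pi.sub_apply] 
      simp
      simp at this
      linarith)
    rw [hge] at k4
    have : H * l / 2 = (d + 1) * M / l + N * l / 2 + ε := by
      rw [hHdef, hAdef]; field_simp; ring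
    linarith
  exact le_of_forall_pos_le_add step

set_option maxHeartbeats 4000000 in
/-- Interior Schauder gradient estimate, Proposition 4.1, eq. (4.1) (with `r = 2^j`):
for a bounded solution `u` (with time derivative `ut`, spatial gradient `gu` and
spatial Hessian `hu`) of `∂ₜu - Δu + a·u = b·∇u + f` on the parabolic ball `Q`,
with `a ≥ 0` and `a, b, f` of finite parabolic Hölder seminorms (bounded by
`Ka, Kb, Kf`) and `|u| ≤ M` on `Q`, the spatial gradient on the half ball `Q'`
is bounded by
`C √r R_b⁻¹ (r^{γ/2} Kf + (r^γ R_b⁻¹ Kb² + r^{γ/2} Ka + r⁻¹) M)`,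
where `R_b⁻¹ = 1 + √r ‖b (t₀, x₀)‖`. -/
theorem schauder_gradient_estimate (d : ℕ) (hd : 1 ≤ d) (γ : ℝ)
    (hγ : γ ∈ Set.Ioo (0 : ℝ) 1) :
    ∃ C : ℝ, 0 < C ∧
      ∀ (t₀ : ℝ) (x₀ : EuclideanSpace ℝ (Fin d)) (r : ℝ), 0 < r →
        ∀ u a f ut : ℝ × EuclideanSpace ℝ (Fin d) → ℝ,
        ∀ b gu : ℝ × EuclideanSpace ℝ (Fin d) → EuclideanSpace ℝ (Fin d),
        ∀ hu : ℝ × EuclideanSpace ℝ (Fin d) →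
            (EuclideanSpace ℝ (Fin d) →L[ℝ] EuclideanSpace ℝ (Fin d)),
        ∀ M Ka Kb Kf : ℝ,
          -- `u` is bounded by `M` on `Q`
          (∀ p ∈ parabolicBall d t₀ x₀ r, |u p| ≤ M) →
          -- `u` is C¹ in time on `Q`, with time derivative `ut`
          (∀ p ∈ parabolicBall d t₀ x₀ r,
            HasDerivAt (fun τ => u (τ, p.2)) (ut p) p.1) →
          ContinuousOn ut (parabolicBall d t₀ x₀ r) →
          -- `u` is C² in space on `Q`, with spatial gradient `gu` and Hessian `hu`
          (∀ p ∈ parabolicBall d t₀ x₀ r,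
            HasGradientAt (fun ξ => u (p.1, ξ)) (gu p) p.2) →
          ContinuousOn gu (parabolicBall d t₀ x₀ r) →
          (∀ p ∈ parabolicBall d t₀ x₀ r,
            HasFDerivAt (fun ξ => gu (p.1, ξ)) (hu p) p.2) →
          ContinuousOn hu (parabolicBall d t₀ x₀ r) →
          -- `a ≥ 0` on `Q`
          (∀ p ∈ parabolicBall d t₀ x₀ r, 0 ≤ a p) →
          -- parabolic Hölder seminorms of `a`, `b`, `f` on `Q` bounded by `Ka`, `Kb`, `Kf`
          (∀ p ∈ parabolicBall d t₀ x₀ r, ∀ q ∈ parabolicBall d t₀ x₀ r,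
            |a p - a q| ≤ Ka * (‖p.2 - q.2‖ ^ γ + |p.1 - q.1| ^ (γ / 2))) →
          (∀ p ∈ parabolicBall d t₀ x₀ r, ∀ q ∈ parabolicBall d t₀ x₀ r,
            ‖b p - b q‖ ≤ Kb * (‖p.2 - q.2‖ ^ γ + |p.1 - q.1| ^ (γ / 2))) →
          (∀ p ∈ parabolicBall d t₀ x₀ r, ∀ q ∈ parabolicBall d t₀ x₀ r,
            |f p - f q| ≤ Kf * (‖p.2 - q.2‖ ^ γ + |p.1 - q.1| ^ (γ / 2))) →
          -- `u` solves `∂ₜ u - Δu + a u = b · ∇u + f` on `Q`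
          (∀ p ∈ parabolicBall d t₀ x₀ r,
            ut p - (∑ i : Fin d, hu p (EuclideanSpace.single i 1) i) + a p * u p
              = ⟪b p, gu p⟫ + f p) →
          ∀ p ∈ parabolicBall d t₀ x₀ (r / 2),
            ‖gu p‖ ≤ C * Real.sqrt r * (1 + Real.sqrt r * ‖b (t₀, x₀)‖) *
              (r ^ (γ / 2) * Kf +
                (r ^ γ * (1 + Real.sqrt r * ‖b (t₀, x₀)‖) * Kb ^ 2 +
                  r ^ (γ / 2) * Ka + r⁻¹) * M) := by
  refine ⟨32 * (d + 1), by positivity, ?_⟩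
  intro t₀ x₀ r hr u a f ut b gu hu M Ka Kb Kf hM h1 c1 h2 c2 h3 _ ha hKa hKb hKf heq p hp
  set ρ := Real.sqrt r with hρ
  have hρ0 : 0 < ρ := Real.sqrt_pos.2 hr
  have hρr : ρ ^ 2 = r := Real.sq_sqrt hr.le
  set k := r ^ (γ / 2) with hk
  have hk0 : 0 < k := Real.rpow_pos_of_pos hr _
  have hkγ : r ^ γ = k ^ 2 := by
    rw [hk, ← Real.rpow_natCast, ← Real.rpow_mul hr.le]; congr 1; push_cast; ring
  have hργ : ρ ^ γ = k := by
    rw [hρ, hk, Real.sqrt_eq_rpow, ← Real.rpow_mul hr.le]; congr 1; ring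
  set Q := parabolicBall d t₀ x₀ r with hQ
  have memQ : ∀ q : ℝ × EuclideanSpace ℝ (Fin d), q ∈ Q ↔
      (t₀ - r ≤ q.1 ∧ q.1 ≤ t₀) ∧ ‖q.2 - x₀‖ ≤ ρ := by
    intro q
    simp [hQ, parabolicBall, Set.mem_prod, Metric.mem_closedBall, dist_eq_norm, hρ]
  have h0Q : (t₀, x₀) ∈ Q := by
    rw [memQ]; simp only [sub_self, norm_zero]; exact ⟨⟨by linarith, le_refl _⟩, hρ0.le⟩
  have h00Q : (t₀ - r, x₀) ∈ Q := by
    rw [memQ]; simp only [sub_self, norm_zero]; exact ⟨⟨le_refl _, by linarith⟩, hρ0.le⟩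
  have hfac : (‖x₀ - x₀‖ ^ γ + |t₀ - (t₀ - r)| ^ (γ / 2)) = k := by
    rw [sub_self, norm_zero, Real.zero_rpow hγ.1.ne', zero_add, sub_sub_cancel, abs_of_pos hr]
  have hKa0 : 0 ≤ Ka := by
    have := (abs_nonneg _).trans (hKa _ h0Q _ h00Q)
    simp only [hfac] at this
    exact nonneg_of_mul_nonneg_left this hk0
  have hKb0 : 0 ≤ Kb := by
    have := (norm_nonneg _).trans (hKb _ h0Q _ h00Q)
    simp only [hfac] at this
    exact nonneg_of_mul_nonneg_left this hk0
  have hKf0 : 0 ≤ Kf := by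
    have := (abs_nonneg _).trans (hKf _ h0Q _ h00Q)
    simp only [hfac] at this
    exact nonneg_of_mul_nonneg_left this hk0
  have hM0 : 0 ≤ M := (abs_nonneg _).trans (hM _ h0Q)
  have hdist : ∀ q ∈ Q, ‖q.2 - x₀‖ ^ γ + |q.1 - t₀| ^ (γ / 2) ≤ 2 * k := by
    intro q hq
    rw [memQ] at hq
    have e1 : ‖q.2 - x₀‖ ^ γ ≤ k := by
      rw [← hργ]; exact Real.rpow_le_rpow (norm_nonneg _) hq.2 hγ.1.le
    have e2 : |q.1 - t₀| ^ (γ / 2) ≤ k := by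
      refine Real.rpow_le_rpow (abs_nonneg _) ?_ (by linarith [hγ.1])
      rw [abs_le]; constructor <;> linarith [hq.1.1, hq.1.2]
    linarith
  set B0 := ‖b (t₀, x₀)‖ with hB0
  have hB00 : 0 ≤ B0 := norm_nonneg _
  set β := B0 + 2 * k * Kb with hβ
  have hβ0 : 0 ≤ β := by positivity
  have hbβ : ∀ q ∈ Q, ‖b q‖ ≤ β := by
    intro q hq
    have e1 := hKb q hq _ h0Q
    have e2 := mul_le_mul_of_nonneg_left (hdist q hq) hKb0
    have e3 : ‖b q‖ ≤ ‖b q - b (t₀, x₀)‖ + ‖b (t₀, x₀)‖ := by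
      simpa using norm_add_le (b q - b (t₀, x₀)) (b (t₀, x₀))
    simp only at e1
    rw [hβ]; linarith
  set N := 2 * k * (Kf + Ka * M) with hN
  have hN0 : 0 ≤ N := by positivity
  have hg : ∀ q ∈ Q, |ut q - (∑ i : Fin d, hu q (EuclideanSpace.single i 1) i)
      + a (t₀, x₀) * u q - f (t₀, x₀)| ≤ β * ‖gu q‖ + N := by
    intro q hq
    have e1 := (hKa q hq _ h0Q).trans (mul_le_mul_of_nonneg_left (hdist q hq) hKa0)
    have e2 := (hKf q hq _ h0Q).trans (mul_le_mul_of_nonneg_left (hdist q hq) hKf0)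
    have e3 : ut q - (∑ i : Fin d, hu q (EuclideanSpace.single i 1) i)
      + a (t₀, x₀) * u q - f (t₀, x₀) =
        ⟪b q, gu q⟫ + (f q - f (t₀, x₀)) - (a q - a (t₀, x₀)) * u q := by
      linarith [heq q hq]
    have e4 : |⟪b q, gu q⟫| ≤ β * ‖gu q‖ :=
      (abs_real_inner_le_norm _ _).trans (mul_le_mul_of_nonneg_right (hbβ q hq) (norm_nonneg _))
    have e5 : |(a q - a (t₀, x₀)) * u q| ≤ Ka * (2 * k) * M := by
      rw [abs_mul]; exact mul_le_mul e1 (hM q hq) (abs_nonneg _) (by positivity)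
    rw [e3]
    calc _ ≤ |⟪b q, gu q⟫ + (f q - f (t₀, x₀))| + |(a q - a (t₀, x₀)) * u q| := abs_sub _ _
      _ ≤ |⟪b q, gu q⟫| + |f q - f (t₀, x₀)| + |(a q - a (t₀, x₀)) * u q| := by
        gcongr; exact abs_add_le _ _
      _ ≤ _ := by rw [hN]; linarith
  -- the weight
  set δ : ℝ × EuclideanSpace ℝ (Fin d) → ℝ := fun q =>
    min (ρ - ‖q.2 - x₀‖) (Real.sqrt (q.1 - (t₀ - r))) with hδ
  have hδc : Continuous δ := by fun_prop
  have hQc : IsCompact Q := by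
    rw [hQ, parabolicBall]; exact isCompact_Icc.prod (isCompact_closedBall _ _)
  have hδ0 : ∀ q ∈ Q, 0 ≤ δ q := by
    intro q hq
    rw [memQ] at hq
    exact le_min (by linarith [hq.2]) (Real.sqrt_nonneg _)
  obtain ⟨q, hq, hqmax⟩ := hQc.exists_isMaxOn ⟨_, h0Q⟩
    (f := fun q => δ q * ‖gu q‖) (hδc.continuousOn.mul c2.norm)
  have hqmax' : ∀ q' ∈ Q, δ q' * ‖gu q'‖ ≤ δ q * ‖gu q‖ := fun q' hq' => hqmax hq'
  have hqm := (memQ q).1 hq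
  -- weighted estimate
  have main : δ q * ‖gu q‖ ≤ 4 * (d + 1) * M * (1 + ρ * β) + N * r := by
    rcases (hδ0 q hq).eq_or_lt with hz | hpos
    · rw [← hz, zero_mul]; positivity
    set D := δ q with hD
    have hD1 : D ≤ ρ - ‖q.2 - x₀‖ := min_le_left _ _
    have hD2 : D ^ 2 ≤ q.1 - (t₀ - r) := by
      rw [← Real.le_sqrt hpos.le (by linarith [hqm.1.1])]; exact min_le_right _ _
    have hDρ : D ≤ ρ := by linarith [norm_nonneg (q.2 - x₀)]
    set G := ‖gu q‖ with hG
    have hG0 : 0 ≤ G := norm_nonneg _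
    set l := D / (2 * (1 + ρ * β)) with hl
    have hden : 1 ≤ 1 + ρ * β := by linarith [mul_nonneg hρ0.le hβ0]
    have hl0 : 0 < l := by positivity
    have hll : l * (2 * (1 + ρ * β)) = D := by rw [hl]; field_simp
    have hlD : l ≤ D / 2 := by linarith [mul_le_mul_of_nonneg_left hden hl0.le]
    have hsub : ∀ q' ∈ Set.Icc (q.1 - l ^ 2) q.1 ×ˢ Metric.closedBall q.2 l,
        q' ∈ Q ∧ D / 2 ≤ δ q' := by
      rintro ⟨s, y⟩ ⟨hs, hy⟩
      simp only [Metric.mem_closedBall, dist_eq_norm] at hs hy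
      have hs1 := hs.1
      have hs2 := hs.2
      have y1 : ‖y - x₀‖ ≤ ‖y - q.2‖ + ‖q.2 - x₀‖ := by
        simpa using norm_add_le (y - q.2) (q.2 - x₀)
      have l2 : l ^ 2 ≤ D ^ 2 / 4 := by linarith [pow_le_pow_left₀ hl0.le hlD 2]
      refine ⟨(memQ _).2 ⟨⟨?_, ?_⟩, ?_⟩, le_min ?_ (Real.le_sqrt_of_sq_le ?_)⟩
      · simp only; linarith [sq_nonneg D]
      · simp only; linarith [hqm.1.2]
      · simp only; linarith
      · simp only; linarith
      · simp only; linarith [sq_nonneg D]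
    have est := aux_gradient (u := u) (ut := ut) (gu := gu) (hu := hu) (T := q.1) (X := q.2)
      (M := M) (N := β * (2 * G) + N) (a0 := a (t₀, x₀)) (f0 := f (t₀, x₀)) hl0 (ha _ h0Q)
      (fun q' h => hM q' (hsub q' h).1) (fun q' h => h1 q' (hsub q' h).1)
      (c1.mono fun q' h => (hsub q' h).1) (fun q' h => h2 q' (hsub q' h).1)
      (c2.mono fun q' h => (hsub q' h).1) (fun q' h => h3 q' (hsub q' h).1) (by
        intro q' h
        obtain ⟨i1, i2⟩ := hsub q' h
        have i3 := hqmax' q' i1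
        have i4 : ‖gu q'‖ ≤ 2 * G := by
          have := mul_le_mul_of_nonneg_right i2 (norm_nonneg (gu q'))
          have : D * ‖gu q'‖ ≤ D * (2 * G) := by linarith
          exact le_of_mul_le_mul_left this hpos
        have := mul_le_mul_of_nonneg_left i4 hβ0
        linarith [hg q' i1])
    have est' : G ≤ (d + 1) * M / l + (β * (2 * G) + N) * l / 2 := est
    have hβl : β * l ≤ 1 / 2 := by
      have e1 : l * 2 * (ρ * β) ≤ D := by linarith
      have e2 : ρ * (2 * (β * l)) ≤ ρ * 1 := by linarith
      linarith [le_of_mul_le_mul_left e2 hρ0]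
    have e3 : G ≤ 2 * ((d + 1) * M / l) + N * l := by
      linarith [mul_le_mul_of_nonneg_right hβl hG0]
    have e4 : D * ((d + 1) * M / l) = 2 * ((d + 1) * M * (1 + ρ * β)) := by
      rw [← hll]; field_simp
    have e5 : D * l ≤ r := by rw [← hρr]; nlinarith
    have e6 := mul_le_mul_of_nonneg_left e3 hpos.le
    have e7 := mul_le_mul_of_nonneg_left e5 hN0
    linarith
  -- conclusion on the half ball
  have hp' : (t₀ - r / 2 ≤ p.1 ∧ p.1 ≤ t₀) ∧ ‖p.2 - x₀‖ ≤ Real.sqrt (r / 2) := by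
    simpa [parabolicBall, Set.mem_prod, Metric.mem_closedBall, dist_eq_norm] using hp
  have hhalf : Real.sqrt (r / 2) ≤ 3 / 4 * ρ := by
    rw [Real.sqrt_le_left (by positivity)]; nlinarith
  have hpQ : p ∈ Q := (memQ p).2 ⟨⟨by linarith [hp'.1.1], hp'.1.2⟩, by linarith [hp'.2]⟩
  have hδp : ρ / 4 ≤ δ p := by
    refine le_min (by linarith [hp'.2]) (Real.le_sqrt_of_sq_le ?_)
    nlinarith [hp'.1.1]
  have fin1 : ρ * ‖gu p‖ ≤ 4 * (4 * (d + 1) * M * (1 + ρ * β) + N * r) := by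
    have := mul_le_mul_of_nonneg_right hδp (norm_nonneg (gu p))
    linarith [hqmax' p hpQ]
  refine le_of_mul_le_mul_left (fin1.trans ?_) hρ0
  rw [hkγ]
  set B := 1 + ρ * B0 with hB
  have hB1 : 1 ≤ B := by linarith [mul_nonneg hρ0.le hB00]
  set κ := ρ * k * Kb with hκ
  have hκ0 : 0 ≤ κ := by positivity
  have t1 : 1 + ρ * β = B + 2 * κ := by rw [hβ, hB, hκ]; ring
  have t2 : ρ * (32 * (d + 1) * ρ * B * (k * Kf + (k ^ 2 * B * Kb ^ 2 + k * Ka + r⁻¹) * M))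
      = 32 * (d + 1) * (B * (r * k * (Kf + Ka * M))) + 32 * (d + 1) * M * (B + B ^ 2 * κ ^ 2) := by
    have : r * r⁻¹ = 1 := mul_inv_cancel₀ hr.ne'
    rw [hκ]
    have e : ρ * (32 * (d + 1) * ρ * B * (k * Kf + (k ^ 2 * B * Kb ^ 2 + k * Ka + r⁻¹) * M))
      = 32 * (d + 1) * B * (ρ ^ 2 * (k * Kf) + (ρ ^ 2 * k ^ 2 * B * Kb ^ 2 + ρ ^ 2 * k * Ka
        + ρ ^ 2 * r⁻¹) * M) := by ring
    rw [e, mul_pow, mul_pow, hρr, this]; ring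
  rw [t1, t2, hN]
  have t3 : B + 2 * κ ≤ 2 * (B + B ^ 2 * κ ^ 2) := by
    have : κ ^ 2 ≤ B ^ 2 * κ ^ 2 := by
      exact le_mul_of_one_le_left (sq_nonneg κ) (one_le_pow₀ hB1)
    linarith [sq_nonneg (κ - 1), sq_nonneg κ]
  have hd0 : (0:ℝ) ≤ d := Nat.cast_nonneg d
  have hP : 0 ≤ r * k * (Kf + Ka * M) := by positivity
  have t4 : 8 * (r * k * (Kf + Ka * M)) ≤ 32 * (d + 1) * (B * (r * k * (Kf + Ka * M))) := by
    have e1 : r * k * (Kf + Ka * M) ≤ B * (r * k * (Kf + Ka * M)) := le_mul_of_one_le_left hP hB1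
    have e2 : 0 ≤ d * (B * (r * k * (Kf + Ka * M))) := by positivity
    linarith
  have t5 : 16 * (d + 1) * M * (B + 2 * κ) ≤ 16 * (d + 1) * M * (2 * (B + B ^ 2 * κ ^ 2)) :=
    mul_le_mul_of_nonneg_left t3 (by positivity)
  linarith
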